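/- Let 𝒜 be a semi-abelian category with enough regular projectives (for every object B there exists a regular epimorphism P→B with P regular projective). Then an object Y of 𝒜 is perfect (every morphism from Y to an abelian object is the zero morphism) if and only if Y admits a universal central extension (a central extension u: U→Y such that for every central extension g: Z→Y there exists exactly one morphism h: U→Z with g∘h = u). -/

import Mathlib

open CategoryTheory CategoryTheory.Limits

universe v u

section Defs

variable {C : Type u} [Category.{v} C]

/-- A finitely complete category is protomodular if, for every commutative diagram of two
adjacent commutative squares in which the middle vertical morphism is a split epimorphism,
whenever the left-hand square and the outer rectangle are pullbacks, so is the right-hand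
square. -/
def Protomodular (C : Type u) [Category.{v} C] : Prop :=
  ∀ ⦃A B D A' B' D' : C⦄ (f : A ⟶ B) (g : B ⟶ D)
    (f' : A' ⟶ B') (g' : B' ⟶ D')
    (a : A ⟶ A') (b : B ⟶ B') (d : D ⟶ D'),
    g ≫ d = b ≫ g' →
    IsSplitEpi b →
    IsPullback f a b f' →
    IsPullback (f ≫ g) a d (f' ≫ g') →
    IsPullback g b d g'

variable [HasZeroMorphisms C] [HasFiniteLimits C]

/-- Two coterminal morphisms `k`, `k'` cooperate (commute in the sense of Huq) when there is
a morphism `φ : K ⨯ K' ⟶ X` restricting to `k` and `k'` along `(1,0)` and `(0,1)`. -/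
def Cooperate {K K' X : C} (k : K ⟶ X) (k' : K' ⟶ X) : Prop :=
  ∃ φ : K ⨯ K' ⟶ X, prod.lift (𝟙 K) 0 ≫ φ = k ∧ prod.lift 0 (𝟙 K') ≫ φ = k'

/-- A morphism is central in the sense of Huq when it cooperates with the identity. -/
def HuqCentral {K X : C} (k : K ⟶ X) : Prop :=
  Cooperate k (𝟙 X)

/-- An object is abelian when its identity cooperates with itself. -/
def IsAbelianObj (A : C) : Prop :=
  Cooperate (𝟙 A) (𝟙 A)

/-- `k` is a kernel of `f`. -/
def IsKernelOf {K X Y : C} (k : K ⟶ X) (f : X ⟶ Y) : Prop :=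
  ∃ w : k ≫ f = 0, Nonempty (IsLimit (KernelFork.ofι k w))

/-- A central extension is a regular epimorphism whose kernel is Huq-central. -/
def IsCentralExt {X Y : C} (f : X ⟶ Y) : Prop :=
  Nonempty (RegularEpi f) ∧ HuqCentral (kernel.ι f)

/-- A normal monomorphism: a morphism that is a kernel of some morphism. -/
def IsNormalMonoP {K X : C} (m : K ⟶ X) : Prop :=
  ∃ (Z : C) (g : X ⟶ Z), IsKernelOf m g

/-- `(p₁, p₂) : R ↣ X ⨯ X` is an internal equivalence relation. -/
structure IsEquivRelation {R X : C} (p₁ p₂ : R ⟶ X) : Prop where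
  mono : Mono (prod.lift p₁ p₂)
  refl : ∃ d : X ⟶ R, d ≫ p₁ = 𝟙 X ∧ d ≫ p₂ = 𝟙 X
  symm : ∃ s : R ⟶ R, s ≫ p₁ = p₂ ∧ s ≫ p₂ = p₁
  trans : ∃ t : pullback p₂ p₁ ⟶ R,
    t ≫ p₁ = pullback.fst p₂ p₁ ≫ p₁ ∧ t ≫ p₂ = pullback.snd p₂ p₁ ≫ p₂

end Defs

/-- A semi-abelian category: pointed, Barr-exact (regular with effective equivalence
relations), protomodular and with binary coproducts. -/
class SemiAbelian (C : Type u) [Category.{v} C] [HasZeroMorphisms C] [HasZeroObject C]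
    [HasFiniteLimits C] [HasBinaryCoproducts C] : Prop where
  /-- Every kernel pair has a coequalizer. -/
  hasCoeqOfKernelPair : ∀ {X Y : C} (f : X ⟶ Y),
    HasCoequalizer (pullback.fst f f) (pullback.snd f f)
  /-- Regular epimorphisms are stable under pullback. -/
  regEpiPullbackStable : ∀ {X Y Z : C} (f : X ⟶ Z) (g : Y ⟶ Z),
    Nonempty (RegularEpi g) → Nonempty (RegularEpi (pullback.fst f g))
  /-- Every internal equivalence relation is effective, i.e. a kernel pair. -/
  equivRelationEffective : ∀ {R X : C} (p₁ p₂ : R ⟶ X), IsEquivRelation p₁ p₂ →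
    ∃ (Y : C) (f : X ⟶ Y), IsKernelPair f p₁ p₂
  /-- The category is protomodular. -/
  protomodular : Protomodular C

/-- An object is regular projective when every morphism from it lifts along every regular
epimorphism. -/
def RegProjective {C : Type u} [Category.{v} C] (P : C) : Prop :=
  ∀ ⦃E B : C⦄ (e : E ⟶ B), Nonempty (RegularEpi e) → ∀ g : P ⟶ B, ∃ h : P ⟶ E, h ≫ e = g

attribute [local simp] prod.lift_fst prod.lift_snd prod.lift_fst_assoc prod.lift_snd_assoc
  prod.map_fst prod.map_snd prod.map_fst_assoc prod.map_snd_assoc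
  pullback.lift_fst pullback.lift_snd pullback.lift_fst_assoc pullback.lift_snd_assoc
  coprod.inl_desc coprod.inr_desc coprod.inl_desc_assoc coprod.inr_desc_assoc
  kernel.lift_ι kernel.lift_ι_assoc coequalizer.π_desc

section Protomodularity

variable {C : Type u} [Category.{v} C] [HasZeroMorphisms C]

lemma IsKernelOf.of_lift {K X Y : C} {k : K ⟶ X} {f : X ⟶ Y} [Mono k] (w : k ≫ f = 0)
    (h : ∀ {V : C} (x : V ⟶ X), x ≫ f = 0 → ∃ l : V ⟶ K, l ≫ k = x) : IsKernelOf k f := by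
  refine ⟨w, ⟨KernelFork.IsLimit.ofι k w (fun x hx => (h x hx).choose)
    (fun x hx => (h x hx).choose_spec) fun x hx m hm => ?_⟩⟩
  rw [← cancel_mono k, hm, (h x hx).choose_spec]

lemma eq_comp_inl_of_comp_snd_eq_zero [HasBinaryProducts C] {V K L : C} (x : V ⟶ K ⨯ L) (h : x ≫ prod.snd = 0) :
    x = (x ≫ prod.fst) ≫ prod.lift (𝟙 K) 0 := by
  ext <;> simp [h]

variable [HasZeroObject C]

open ZeroObject in
lemma IsKernelOf.isPullback {K X Y : C} {k : K ⟶ X} {f : X ⟶ Y} (h : IsKernelOf k f) :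
    IsPullback k (0 : K ⟶ (0 : C)) f (0 : (0 : C) ⟶ Y) := by
  obtain ⟨w, ⟨hl⟩⟩ := h
  refine ⟨⟨by simp [w]⟩, ⟨PullbackCone.IsLimit.mk _
    (fun s => hl.lift (KernelFork.ofι s.fst (by simpa using s.condition))) (fun s => ?_)
    (fun s => Subsingleton.elim _ _) fun s m hm _ => ?_⟩⟩
  · exact hl.fac (KernelFork.ofι s.fst _) WalkingParallelPair.zero
  · refine Fork.IsLimit.hom_ext hl ?_
    exact hm.trans (hl.fac (KernelFork.ofι s.fst _) WalkingParallelPair.zero).symm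

/-- The split short five lemma, with a common codomain. -/
lemma Protomodular.isIso_of_isKernelOf (hC : Protomodular C) {K M A B : C} (m : M ⟶ A)
    (b : M ⟶ B) (p : A ⟶ B) [hb : IsSplitEpi b] (w : m ≫ p = b) (k : K ⟶ M)
    (hk : IsKernelOf k b) (hk' : IsKernelOf (k ≫ m) p) : IsIso m := by
  have := hC k m 0 (𝟙 B) 0 b p (by simpa using w) hb hk.isPullback
    (by simpa using hk'.isPullback)
  exact this.isIso_fst_of_isIso

variable [HasFiniteLimits C]

/-- The kernel and the section of a split epimorphism are jointly extremal epimorphic. -/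
lemma Protomodular.isIso_of_mono (hC : Protomodular C) {M A B : C} (m : M ⟶ A) [Mono m]
    (p : A ⟶ B) (s : B ⟶ A) (hs : s ≫ p = 𝟙 B) (hsm : ∃ s' : B ⟶ M, s' ≫ m = s)
    (hk : ∀ {V : C} (x : V ⟶ A), x ≫ p = 0 → ∃ x' : V ⟶ M, x' ≫ m = x) : IsIso m := by
  obtain ⟨s', hs'⟩ := hsm
  have : IsSplitEpi (m ≫ p) := ⟨⟨⟨s', by rw [← Category.assoc, hs', hs]⟩⟩⟩
  refine hC.isIso_of_isKernelOf m (m ≫ p) p rfl (kernel.ι (m ≫ p))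
    ⟨kernel.condition _, ⟨kernelIsKernel _⟩⟩ (.of_lift (by simp) fun x hx => ?_)
  obtain ⟨x', rfl⟩ := hk x hx
  exact ⟨kernel.lift _ x' (by simpa using hx), by simp⟩

/-- The kernel and the section of a split epimorphism are jointly epimorphic. -/
lemma Protomodular.hom_ext (hC : Protomodular C) {A B Z : C} (p : A ⟶ B) (s : B ⟶ A)
    (hs : s ≫ p = 𝟙 B) {f g : A ⟶ Z} (h : s ≫ f = s ≫ g)
    (hk : ∀ {V : C} (x : V ⟶ A), x ≫ p = 0 → x ≫ f = x ≫ g) : f = g := by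
  have : IsIso (equalizer.ι f g) := hC.isIso_of_mono _ p s hs ⟨equalizer.lift s h, by simp⟩
    fun x hx => ⟨equalizer.lift x (hk x hx), by simp⟩
  rw [← cancel_epi (equalizer.ι f g), equalizer.condition]

lemma Protomodular.prod_isIso_of_mono (hC : Protomodular C) {M K L : C} (m : M ⟶ K ⨯ L) [Mono m]
    (h₁ : ∃ x, x ≫ m = prod.lift (𝟙 K) 0) (h₂ : ∃ x, x ≫ m = prod.lift 0 (𝟙 L)) : IsIso m := by
  obtain ⟨y, hy⟩ := h₁
  refine hC.isIso_of_mono m prod.snd (prod.lift 0 (𝟙 L)) (by simp) h₂ fun x hx => ?_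
  exact ⟨(x ≫ prod.fst) ≫ y, by
    rw [Category.assoc, hy, ← eq_comp_inl_of_comp_snd_eq_zero x hx]⟩

lemma Protomodular.prod_hom_ext (hC : Protomodular C) {K L Z : C} {f g : K ⨯ L ⟶ Z}
    (h₁ : prod.lift (𝟙 K) 0 ≫ f = prod.lift (𝟙 K) 0 ≫ g)
    (h₂ : prod.lift 0 (𝟙 L) ≫ f = prod.lift 0 (𝟙 L) ≫ g) : f = g := by
  refine hC.hom_ext prod.snd (prod.lift 0 (𝟙 L)) (by simp) h₂ fun x hx => ?_
  rw [eq_comp_inl_of_comp_snd_eq_zero x hx, Category.assoc, h₁, ← Category.assoc]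

/-- A reflexive relation is Euclidean. -/
lemma Protomodular.exists_of_reflexive (hC : Protomodular C) {R X : C} (p₁ p₂ : R ⟶ X)
    [Mono (prod.lift p₁ p₂)] (d : X ⟶ R) (hd₁ : d ≫ p₁ = 𝟙 X) (hd₂ : d ≫ p₂ = 𝟙 X)
    {V : C} (a b : V ⟶ R) (hab : a ≫ p₁ = b ≫ p₁) :
    ∃ c : V ⟶ R, c ≫ p₁ = a ≫ p₂ ∧ c ≫ p₂ = b ≫ p₂ := by
  let w : pullback p₁ p₁ ⟶ X ⨯ X :=
    prod.lift (pullback.fst p₁ p₁ ≫ p₂) (pullback.snd p₁ p₁ ≫ p₂)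
  let m := pullback.fst w (prod.lift p₁ p₂)
  have : IsIso m := by
    refine hC.isIso_of_mono m (pullback.fst p₁ p₁) (pullback.lift (𝟙 R) (𝟙 R) rfl) (by simp)
      ⟨pullback.lift (pullback.lift (𝟙 R) (𝟙 R) rfl) (p₂ ≫ d) ?_, pullback.lift_fst _ _ _⟩ fun x hx => ?_
    · ext <;> simp [w, hd₁, hd₂]
    · refine ⟨pullback.lift x (x ≫ pullback.snd _ _) ?_, pullback.lift_fst _ _ _⟩
      have h0 : x ≫ pullback.snd p₁ p₁ ≫ p₁ = 0 := by
        rw [← pullback.condition, reassoc_of% hx, zero_comp]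
      ext <;> simp [w, h0, reassoc_of% hx]
  let c := pullback.lift a b hab ≫ inv m ≫ pullback.snd w (prod.lift p₁ p₂)
  have hc : c ≫ prod.lift p₁ p₂ = prod.lift (a ≫ p₂) (b ≫ p₂) := by
    simp only [c, Category.assoc, ← pullback.condition]
    change _ ≫ inv m ≫ m ≫ w = _
    rw [IsIso.inv_hom_id_assoc]
    ext <;> simp [w]
  exact ⟨c, by simpa using hc =≫ prod.fst, by simpa using hc =≫ prod.snd⟩

/-- Protomodular categories are Mal'tsev: every reflexive relation is an equivalence relation. -/
lemma Protomodular.isEquivRelation_of_reflexive (hC : Protomodular C) {R X : C} (p₁ p₂ : R ⟶ X)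
    [Mono (prod.lift p₁ p₂)] (d : X ⟶ R) (hd₁ : d ≫ p₁ = 𝟙 X) (hd₂ : d ≫ p₂ = 𝟙 X) :
    IsEquivRelation p₁ p₂ := by
  obtain ⟨s, hs₁, hs₂⟩ := hC.exists_of_reflexive p₁ p₂ d hd₁ hd₂ (𝟙 R) (p₁ ≫ d) (by simp [hd₁])
  refine ⟨inferInstance, ⟨d, hd₁, hd₂⟩, ⟨s, by simpa using hs₁, by simpa [hd₂] using hs₂⟩, ?_⟩
  obtain ⟨t, ht₁, ht₂⟩ := hC.exists_of_reflexive p₁ p₂ d hd₁ hd₂ (pullback.fst p₂ p₁ ≫ s)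
    (pullback.snd p₂ p₁) (by simpa [hs₁] using pullback.condition)
  exact ⟨t, by simpa [hs₂, hd₂] using ht₁, ht₂⟩

end Protomodularity

section Cooperation

variable {C : Type u} [Category.{v} C] [HasZeroMorphisms C] [HasFiniteLimits C]

lemma Cooperate.precomp {K K' L L' X : C} {k : K ⟶ X} {k' : K' ⟶ X} (h : Cooperate k k')
    (a : L ⟶ K) (b : L' ⟶ K') : Cooperate (a ≫ k) (b ≫ k') := by
  obtain ⟨φ, h₁, h₂⟩ := h
  refine ⟨prod.map a b ≫ φ, ?_, ?_⟩
  · rw [← h₁, ← Category.assoc, ← Category.assoc]; congr 1; ext <;> simp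
  · rw [← h₂, ← Category.assoc, ← Category.assoc]; congr 1; ext <;> simp

lemma Cooperate.postcomp {K K' X Z : C} {k : K ⟶ X} {k' : K' ⟶ X} (h : Cooperate k k')
    (f : X ⟶ Z) : Cooperate (k ≫ f) (k' ≫ f) := by
  obtain ⟨φ, h₁, h₂⟩ := h
  exact ⟨φ ≫ f, by rw [← Category.assoc, h₁], by rw [← Category.assoc, h₂]⟩

lemma Cooperate.zero_left {K K' X : C} (k' : K' ⟶ X) : Cooperate (0 : K ⟶ X) k' :=
  ⟨prod.snd ≫ k', by simp, by simp⟩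

lemma HuqCentral.cooperate_self {K X : C} {k : K ⟶ X} (h : HuqCentral k) : Cooperate k k := by
  simpa using Cooperate.precomp h (𝟙 K) k

lemma IsAbelianObj.cooperate_self {X A : C} (h : IsAbelianObj A) (d : X ⟶ A) : Cooperate d d := by
  simpa using Cooperate.precomp h d d

variable [HasZeroObject C]

lemma Cooperate.of_comp_mono (hC : Protomodular C) {K K' X Z : C} {k : K ⟶ X} {k' : K' ⟶ X}
    (m : X ⟶ Z) [Mono m] (h : Cooperate (k ≫ m) (k' ≫ m)) : Cooperate k k' := by
  obtain ⟨φ, h₁, h₂⟩ := h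
  have : IsIso (pullback.fst φ m) := hC.prod_isIso_of_mono _
    ⟨pullback.lift _ k h₁, by simp⟩ ⟨pullback.lift _ k' h₂, by simp⟩
  refine ⟨inv (pullback.fst φ m) ≫ pullback.snd φ m, ?_, ?_⟩ <;>
    simpa [← cancel_mono m, ← pullback.condition]

lemma HuqCentral.isAbelianObj (hC : Protomodular C) {K X : C} {k : K ⟶ X} [Mono k]
    (h : HuqCentral k) : IsAbelianObj K :=
  .of_comp_mono hC k (by simpa using h.cooperate_self)

/-- Restricting a morphism with central kernel along a monomorphism. -/
lemma HuqCentral.kernel_comp_of_mono (hC : Protomodular C) {E Z Y : C} (i : E ⟶ Z) [Mono i]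
    {g : Z ⟶ Y} (h : HuqCentral (kernel.ι g)) : HuqCentral (kernel.ι (i ≫ g)) := by
  refine Cooperate.of_comp_mono hC i ?_
  simpa using Cooperate.precomp h (kernel.lift g (kernel.ι (i ≫ g) ≫ i) (by simp)) i

/-- Two morphisms identified by a morphism `g` with central kernel differ by a morphism into
the kernel of `g`. -/
lemma HuqCentral.exists_difference (hC : Protomodular C) {W Z Y : C} {g : Z ⟶ Y}
    (hg : HuqCentral (kernel.ι g)) (h k : W ⟶ Z) (hk : h ≫ g = k ≫ g) :
    ∃ d : W ⟶ kernel g, ∀ {V : C} (x : V ⟶ W), x ≫ d = 0 → x ≫ h = x ≫ k := by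
  obtain ⟨φ, h₁, h₂⟩ := hg
  have hφ : φ ≫ g = prod.snd ≫ g :=
    hC.prod_hom_ext (by simp [reassoc_of% h₁]) (by simp [reassoc_of% h₂])
  let m : kernel g ⨯ Z ⟶ pullback g g := pullback.lift φ prod.snd hφ
  have : Mono (prod.lift (𝟙 (kernel g)) (0 : kernel g ⟶ Z)) :=
    mono_of_mono_fac (prod.lift_fst _ _)
  have hkm : prod.lift (𝟙 (kernel g)) 0 ≫ m = pullback.lift (kernel.ι g) 0 (by simp) := by
    ext <;> simp [m, h₁]
  have : Mono (pullback.lift (f := g) (g := g) (kernel.ι g) 0 (by simp)) :=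
    mono_of_mono_fac (pullback.lift_fst _ _ _)
  have : IsIso m := by
    refine hC.isIso_of_isKernelOf m prod.snd (pullback.snd g g) (by simp [m])
      (prod.lift (𝟙 (kernel g)) 0) (.of_lift (by simp) fun x hx =>
        ⟨x ≫ prod.fst, (eq_comp_inl_of_comp_snd_eq_zero x hx).symm⟩) ?_
    rw [hkm]
    refine .of_lift (by simp) fun x hx => ⟨kernel.lift g (x ≫ pullback.fst g g) ?_, ?_⟩
    · rw [Category.assoc, pullback.condition, reassoc_of% hx, zero_comp]
    · ext <;> simp [hx]
  let y := pullback.lift h k hk ≫ inv m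
  have hy : y ≫ m = pullback.lift h k hk := by simp [y]
  refine ⟨y ≫ prod.fst, fun x hx => ?_⟩
  have hyφ : y ≫ φ = h := by simpa [m] using hy =≫ pullback.fst g g
  have hyk : y ≫ prod.snd = k := by simpa [m] using hy =≫ pullback.snd g g
  have hxy : x ≫ y = (x ≫ k) ≫ prod.lift 0 (𝟙 Z) := by
    apply Limits.prod.hom_ext
    · simpa using hx
    · simp [hyk]
  rw [← hyφ, reassoc_of% hxy, h₂, Category.comp_id]

end Cooperation

section SemiAbelianCategories

variable {C : Type u} [Category.{v} C] [HasZeroMorphisms C] [HasZeroObject C]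
  [HasFiniteLimits C] [HasBinaryCoproducts C] [SemiAbelian C]

instance SemiAbelian.regular : Regular C where
  hasCoequalizer_of_isKernelPair {X Y Z f g₁ g₂} h := by
    have := SemiAbelian.hasCoeqOfKernelPair f
    exact hasColimit_of_iso (F := parallelPair (pullback.fst f f) (pullback.snd f f))
      (parallelPair.ext h.isoPullback (Iso.refl _) (by simp) (by simp))
  regularEpiIsStableUnderBaseChange := by
    refine .mk' fun X Y S f g _ hg => ?_
    obtain ⟨h⟩ := SemiAbelian.regEpiPullbackStable f g hg.1
    exact ⟨⟨h⟩⟩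

lemma isRegularEpi_of_forall_mono {X Y : C} (f : X ⟶ Y)
    (h : ∀ {M : C} (p : X ⟶ M) (m : M ⟶ Y) [Mono m], p ≫ m = f → IsIso m) : IsRegularEpi f := by
  have : ExtremalEpi f := .mk_of_hasEqualizers _ fun _ p m hpm _ => h p m hpm
  infer_instance

lemma isRegularEpi_comp {X Y Z : C} (f : X ⟶ Y) (g : Y ⟶ Z) [IsRegularEpi f] [IsRegularEpi g] :
    IsRegularEpi (f ≫ g) := by
  have : StrongEpi (f ≫ g) := strongEpi_comp f g
  infer_instance

lemma isRegularEpi_of_comp {X Y Z : C} (f : X ⟶ Y) (g : Y ⟶ Z) [IsRegularEpi (f ≫ g)] :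
    IsRegularEpi g := by
  have : StrongEpi g := strongEpi_of_strongEpi f g
  infer_instance

/-- A regular epimorphism is the cokernel of its kernel. -/
lemma IsRegularEpi.exists_desc {X Y Z : C} (q : X ⟶ Y) [IsRegularEpi q] (f : X ⟶ Z)
    (h : ∀ {V : C} (x : V ⟶ X), x ≫ q = 0 → x ≫ f = 0) : ∃ f' : Y ⟶ Z, q ≫ f' = f := by
  have hf : pullback.fst q q ≫ f = pullback.snd q q ≫ f := by
    refine SemiAbelian.protomodular.hom_ext (pullback.fst q q) (pullback.lift (𝟙 X) (𝟙 X) rfl)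
      (by simp) (by simp) fun x hx => ?_
    have := h (x ≫ pullback.snd q q) (by
      rw [Category.assoc, ← pullback.condition, reassoc_of% hx, zero_comp])
    rw [reassoc_of% hx, zero_comp, ← Category.assoc, this]
  refine ⟨IsRegularEpi.desc q f ?_, IsRegularEpi.fac q f _⟩
  simpa using pullback.lift (IsRegularEpi.left q) (IsRegularEpi.right q) (IsRegularEpi.w q) ≫= hf

lemma exists_isRegularEpi_mono_fac {X Y : C} (f : X ⟶ Y) :
    ∃ (I : C) (e : X ⟶ I) (m : I ⟶ Y), IsRegularEpi e ∧ Mono m ∧ e ≫ m = f :=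
  let F := Regular.strongEpiMonoFactorisation f
  ⟨F.I, F.e, F.m, inferInstanceAs (IsRegularEpi (Regular.strongEpiMonoFactorisation f).e),
    inferInstance, F.fac⟩

instance isRegularEpi_prodMap {K K' L L' : C} (a : K ⟶ L) (b : K' ⟶ L') [IsRegularEpi a]
    [IsRegularEpi b] : IsRegularEpi (prod.map a b) := by
  refine isRegularEpi_of_forall_mono _ fun p m _ hp => ?_
  have sq₁ : CommSq (prod.lift (𝟙 K) 0 ≫ p) a m (prod.lift (𝟙 L) 0) :=
    ⟨by simp [hp]⟩
  have sq₂ : CommSq (prod.lift 0 (𝟙 K') ≫ p) b m (prod.lift 0 (𝟙 L')) :=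
    ⟨by simp [hp]⟩
  exact SemiAbelian.protomodular.prod_isIso_of_mono m ⟨sq₁.lift, sq₁.fac_right⟩
    ⟨sq₂.lift, sq₂.fac_right⟩

lemma Cooperate.of_regularEpi_comp {K K' L L' X : C} (a : K ⟶ L) (b : K' ⟶ L') [IsRegularEpi a]
    [IsRegularEpi b] {k : L ⟶ X} {k' : L' ⟶ X} (h : Cooperate (a ≫ k) (b ≫ k')) :
    Cooperate k k' := by
  obtain ⟨φ, h₁, h₂⟩ := h
  have hker : prod.map (kernel.ι a) (kernel.ι b) ≫ φ = 0 := by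
    refine SemiAbelian.protomodular.prod_hom_ext ?_ ?_
    · have : prod.lift (𝟙 _) 0 ≫ prod.map (kernel.ι a) (kernel.ι b) =
          kernel.ι a ≫ prod.lift (𝟙 K) 0 := by ext <;> simp
      rw [reassoc_of% this, h₁]; simp
    · have : prod.lift 0 (𝟙 _) ≫ prod.map (kernel.ι a) (kernel.ι b) =
          kernel.ι b ≫ prod.lift 0 (𝟙 K') := by ext <;> simp
      rw [reassoc_of% this, h₂]; simp
  obtain ⟨ψ, hψ⟩ := IsRegularEpi.exists_desc (prod.map a b) φ fun x hx => by
    have hx₁ : (x ≫ prod.fst) ≫ a = 0 := by simpa using hx =≫ prod.fst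
    have hx₂ : (x ≫ prod.snd) ≫ b = 0 := by simpa using hx =≫ prod.snd
    have : x = prod.lift (kernel.lift a _ hx₁) (kernel.lift b _ hx₂) ≫
        prod.map (kernel.ι a) (kernel.ι b) := by ext <;> simp
    rw [this, Category.assoc, hker, comp_zero]
  refine ⟨ψ, ?_, ?_⟩
  · rw [← cancel_epi a, ← h₁, ← hψ, ← Category.assoc, ← Category.assoc]
    congr 1; ext <;> simp
  · rw [← cancel_epi b, ← h₂, ← hψ, ← Category.assoc, ← Category.assoc]
    congr 1; ext <;> simp

lemma Cooperate.isAbelianObj {X A : C} {q : X ⟶ A} [IsRegularEpi q] (h : Cooperate q q) :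
    IsAbelianObj A :=
  .of_regularEpi_comp q q (by simpa using h)

/-- A pair of morphisms whose image is a reflexive relation has a coequalizer, whose kernel pair
is that image. -/
lemma exists_coequalizer_of_reflexive {D R X : C} (p₁ p₂ : R ⟶ X) (d : D ⟶ R) (t : D ⟶ X)
    [IsRegularEpi t] (hd₁ : d ≫ p₁ = t) (hd₂ : d ≫ p₂ = t) :
    ∃ (N : C) (r : X ⟶ N) (w : p₁ ≫ r = p₂ ≫ r), IsRegularEpi r ∧
      (∀ {Z : C} (h : X ⟶ Z), p₁ ≫ h = p₂ ≫ h → ∃ h' : N ⟶ Z, r ≫ h' = h) ∧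
      IsRegularEpi (pullback.lift p₁ p₂ w) := by
  obtain ⟨I, e, m, _, _, hem⟩ := exists_isRegularEpi_mono_fac (prod.lift p₁ p₂)
  let i₁ : I ⟶ X := m ≫ prod.fst
  let i₂ : I ⟶ X := m ≫ prod.snd
  have h₁ : e ≫ i₁ = p₁ := by simp [i₁, reassoc_of% hem]
  have h₂ : e ≫ i₂ = p₂ := by simp [i₂, reassoc_of% hem]
  have hm : prod.lift i₁ i₂ = m := by ext <;> simp [i₁, i₂]
  have : Mono (prod.lift i₁ i₂) := by rw [hm]; infer_instance
  have sq : CommSq (d ≫ e) t (prod.lift i₁ i₂) (prod.lift (𝟙 X) (𝟙 X)) :=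
    ⟨by ext <;> simp [h₁, h₂, hd₁, hd₂]⟩
  obtain ⟨Y, f, hf⟩ := SemiAbelian.equivRelationEffective i₁ i₂
    (SemiAbelian.protomodular.isEquivRelation_of_reflexive i₁ i₂ sq.lift
      (by simpa using sq.fac_right =≫ prod.fst) (by simpa using sq.fac_right =≫ prod.snd))
  have := Regular.hasCoequalizer_of_isKernelPair hf
  let r := coequalizer.π i₁ i₂
  have hr : IsKernelPair r i₁ i₂ :=
    .cancel_right (f₂ := coequalizer.desc f hf.w) (coequalizer.condition _ _) (by simpa [r] using hf)
  have w : p₁ ≫ r = p₂ ≫ r := by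
    rw [← h₁, ← h₂, Category.assoc, hr.w, ← Category.assoc]
  refine ⟨_, r, w, inferInstance, fun h hh => ?_, ?_⟩
  · refine ⟨coequalizer.desc h ?_, coequalizer.π_desc _ _⟩
    rw [← cancel_epi e, ← Category.assoc, h₁, ← Category.assoc, h₂, hh]
  · have : pullback.lift p₁ p₂ w = e ≫ hr.isoPullback.hom := by
      ext <;> simp [h₁, h₂]
    rw [this]
    exact isRegularEpi_comp _ _

/-- The universal quotient of `X` in which the image of `k : K ⟶ X` becomes central. -/
lemma exists_universal_cooperate {K X : C} (k : K ⟶ X) :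
    ∃ (Q : C) (q : X ⟶ Q), IsRegularEpi q ∧ Cooperate (k ≫ q) q ∧
      ∀ {Z : C} (h : X ⟶ Z), Cooperate (k ≫ h) h → ∃ h' : Q ⟶ Z, q ≫ h' = h := by
  let r : K ⨿ X ⟶ K ⨯ X := coprod.desc (prod.lift (𝟙 K) 0) (prod.lift 0 (𝟙 X))
  let f : K ⨿ X ⟶ X := coprod.desc k (𝟙 X)
  have : IsRegularEpi r := isRegularEpi_of_forall_mono _ fun p m _ hp =>
    SemiAbelian.protomodular.prod_isIso_of_mono m ⟨coprod.inl ≫ p, by simp [hp, r]⟩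
      ⟨coprod.inr ≫ p, by simp [hp, r]⟩
  obtain ⟨Q, q, w, hq, huniv, -⟩ := exists_coequalizer_of_reflexive
    (pullback.fst r r ≫ f) (pullback.snd r r ≫ f) (coprod.inr ≫ pullback.lift (𝟙 _) (𝟙 _) rfl)
    (𝟙 X) (by simp [f]) (by simp [f])
  refine ⟨Q, q, hq, ?_, fun h ⟨φ, h₁, h₂⟩ => huniv h ?_⟩
  · have hw : IsRegularEpi.left r ≫ f ≫ q = IsRegularEpi.right r ≫ f ≫ q := by
      simpa using
        pullback.lift (IsRegularEpi.left r) (IsRegularEpi.right r) (IsRegularEpi.w r) ≫= w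
    have hfac := IsRegularEpi.fac r (f ≫ q) hw
    have h₁ : coprod.inl ≫ r = prod.lift (𝟙 K) 0 := by simp [r]
    have h₂ : coprod.inr ≫ r = prod.lift 0 (𝟙 X) := by simp [r]
    refine ⟨IsRegularEpi.desc r (f ≫ q) hw, ?_, ?_⟩
    · rw [← h₁, Category.assoc, hfac]; simp [f]
    · rw [← h₂, Category.assoc, hfac]; simp [f]
  · have hr : f ≫ h = r ≫ φ := by ext <;> simp [r, f, h₁, h₂]
    rw [Category.assoc, hr, pullback.condition_assoc, Category.assoc, hr]

/-- A regular epimorphism onto a perfect object restricts to a regular epimorphism on the kernel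
of any morphism into an abelian object. -/
lemma isRegularEpi_kernel_comp {Y : C} (hY : ∀ (A : C) (a : Y ⟶ A), IsAbelianObj A → a = 0)
    {Z A : C} (g : Z ⟶ Y) [IsRegularEpi g] (d : Z ⟶ A) (hA : IsAbelianObj A) :
    IsRegularEpi (kernel.ι d ≫ g) := by
  obtain ⟨I, q, m, _, _, hqm⟩ := exists_isRegularEpi_mono_fac d
  have hq : Cooperate q q :=
    .of_comp_mono SemiAbelian.protomodular m (by rw [hqm]; exact hA.cooperate_self d)
  obtain ⟨N, r, w, hr, -, hl⟩ := exists_coequalizer_of_reflexive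
    (pullback.fst q q ≫ g) (pullback.snd q q ≫ g) (pullback.lift (𝟙 Z) (𝟙 Z) rfl) g
    (by simp) (by simp)
  obtain ⟨t, ht⟩ := IsRegularEpi.exists_desc q (g ≫ r) fun x hx => by
    have hx' : x ≫ q = 0 ≫ q := by simp [hx]
    simpa using pullback.lift x 0 hx' ≫= w
  have hgr : IsRegularEpi (g ≫ r) := isRegularEpi_comp g r
  have hN : Cooperate (g ≫ r) (g ≫ r) := by simpa [ht] using hq.postcomp t
  have hr0 : r = 0 := hY N r hN.isAbelianObj
  let ℓ := pullback.lift _ _ w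
  let c := pullback.fst (pullback.lift (f := r) (g := r) 0 (𝟙 Y) (by simp [hr0])) ℓ
  let c' := pullback.snd (pullback.lift (f := r) (g := r) 0 (𝟙 Y) (by simp [hr0])) ℓ
  have hc : IsRegularEpi c := inferInstance
  have hc₁ : (c' ≫ pullback.fst q q) ≫ g = 0 := by
    have := pullback.condition (f := pullback.lift (f := r) (g := r) 0 (𝟙 Y) (by simp [hr0]))
      (g := ℓ) =≫ pullback.fst r r
    simpa [ℓ] using this.symm
  have hc₂ : c' ≫ pullback.snd q q ≫ g = c := by
    have := pullback.condition (f := pullback.lift (f := r) (g := r) 0 (𝟙 Y) (by simp [hr0]))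
      (g := ℓ) =≫ pullback.snd r r
    simpa [ℓ] using this.symm
  have hsnd : IsRegularEpi (pullback.snd (kernel.ι g ≫ q) q ≫ g) := by
    let l : _ ⟶ pullback (kernel.ι g ≫ q) q := pullback.lift (kernel.lift g _ hc₁)
      (c' ≫ pullback.snd q q) (by simp [pullback.condition])
    have hl : l ≫ pullback.snd (kernel.ι g ≫ q) q ≫ g = c := by simpa [l] using hc₂
    rw [← hl] at hc
    exact isRegularEpi_of_comp l _
  refine isRegularEpi_of_forall_mono _ fun p m _ hp => ?_
  let n := pullback.fst (pullback.snd (kernel.ι g ≫ q) q ≫ g) m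
  have : IsIso n := by
    refine SemiAbelian.protomodular.isIso_of_mono n (pullback.fst (kernel.ι g ≫ q) q)
      (pullback.lift (𝟙 _) (kernel.ι g) (by simp)) (by simp)
      ⟨pullback.lift (pullback.lift (𝟙 _) (kernel.ι g) (by simp)) 0 (by simp), by simp [n]⟩
      fun x hx => ?_
    have hx' : (x ≫ pullback.snd (kernel.ι g ≫ q) q) ≫ d = 0 := by
      rw [← hqm, Category.assoc, ← pullback.condition_assoc, reassoc_of% hx, zero_comp]
    exact ⟨pullback.lift x (kernel.lift d _ hx' ≫ p) (by simp [hp]), by simp [n]⟩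
  have hfac : (inv n ≫ pullback.snd _ m) ≫ m = pullback.snd (kernel.ι g ≫ q) q ≫ g := by
    rw [Category.assoc, ← pullback.condition]
    exact IsIso.inv_hom_id_assoc n _
  rw [← hfac] at hsnd
  have := isRegularEpi_of_comp (inv n ≫ pullback.snd _ m) m
  exact isIso_of_regularEpi_of_mono m (IsRegularEpi.getStruct m)

/-- A central extension of `Y` mapping to every central extension of `Y`. -/
lemma exists_weakly_initial_centralExt
    (hproj : ∀ B : C, ∃ (P : C) (e : P ⟶ B), RegProjective P ∧ Nonempty (RegularEpi e)) (Y : C) :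
    ∃ (F : C) (f : F ⟶ Y), IsCentralExt f ∧
      ∀ (Z : C) (g : Z ⟶ Y), IsCentralExt g → ∃ h : F ⟶ Z, h ≫ g = f := by
  obtain ⟨P, e, hP, ⟨he⟩⟩ := hproj Y
  have : IsRegularEpi e := ⟨⟨he⟩⟩
  obtain ⟨F, q, hq, hcoop, huniv⟩ := exists_universal_cooperate (kernel.ι e)
  obtain ⟨f, hf⟩ := huniv e (by simpa using Cooperate.zero_left e)
  refine ⟨F, f, ⟨?_, ?_⟩, fun Z g ⟨⟨hg⟩, hgc⟩ => ?_⟩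
  · rw [← hf] at this
    have := isRegularEpi_of_comp q f
    exact ⟨IsRegularEpi.getStruct f⟩
  · let k := pullback.fst (kernel.ι f) q
    let l := kernel.lift e (pullback.snd (kernel.ι f) q) (by simp [← hf, ← pullback.condition_assoc])
    refine .of_regularEpi_comp k q ?_
    have : k ≫ kernel.ι f = l ≫ kernel.ι e ≫ q := by simp [k, l, pullback.condition]
    simpa [this] using Cooperate.precomp hcoop l (𝟙 P)
  · obtain ⟨h, hh⟩ := hP g ⟨hg⟩ e
    have hw : (kernel.ι e ≫ h) ≫ g = 0 := by simp [hh]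
    have hk : Cooperate (kernel.ι e ≫ h) h := by
      simpa using Cooperate.precomp hgc (kernel.lift g _ hw) h
    obtain ⟨h', hh'⟩ := huniv h hk
    exact ⟨h', by rw [← cancel_epi q, reassoc_of% hh', hh, hf]⟩

end SemiAbelianCategories

/-- In a semi-abelian category with enough regular projectives, an object is perfect if
and only if it admits a universal central extension. -/
theorem statement10 {C : Type u} [Category.{v} C] [HasZeroMorphisms C] [HasZeroObject C]
    [HasFiniteLimits C] [HasBinaryCoproducts C] [SemiAbelian C]
    (hproj : ∀ B : C, ∃ (P : C) (e : P ⟶ B), RegProjective P ∧ Nonempty (RegularEpi e))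
    (Y : C) :
    (∀ (A : C) (a : Y ⟶ A), IsAbelianObj A → a = 0) ↔
      ∃ (U : C) (u : U ⟶ Y), IsCentralExt u ∧
        ∀ (Z : C) (g : Z ⟶ Y), IsCentralExt g → ∃! h : U ⟶ Z, h ≫ g = u := by
  constructor
  · intro hY
    obtain ⟨F, f, ⟨⟨hf⟩, hfc⟩, hF⟩ := exists_weakly_initial_centralExt hproj Y
    have : IsRegularEpi f := ⟨⟨hf⟩⟩
    have hC : Protomodular C := SemiAbelian.protomodular
    obtain ⟨A, η, hη, hcoop, huniv⟩ := exists_universal_cooperate (𝟙 F)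
    have hA : IsAbelianObj A := Cooperate.isAbelianObj (q := η) (by simpa using hcoop)
    have hu : IsRegularEpi (kernel.ι η ≫ f) := isRegularEpi_kernel_comp hY f η hA
    have huc : HuqCentral (kernel.ι (kernel.ι η ≫ f)) := hfc.kernel_comp_of_mono hC _
    refine ⟨kernel η, kernel.ι η ≫ f, ⟨hu.1, huc⟩, fun Z g hg => ?_⟩
    obtain ⟨h, hh⟩ := hF Z g hg
    refine ⟨kernel.ι η ≫ h, by simp [hh], fun k hk => ?_⟩
    obtain ⟨d, hd⟩ := hg.2.exists_difference hC k (kernel.ι η ≫ h) (by simp [hk, hh])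
    have hE : IsRegularEpi (kernel.ι d ≫ kernel.ι η ≫ f) :=
      isRegularEpi_kernel_comp hY _ d (hg.2.isAbelianObj hC)
    obtain ⟨w, hw⟩ := hF _ (kernel.ι d ≫ kernel.ι η ≫ f) ⟨hE.1, huc.kernel_comp_of_mono hC _⟩
    obtain ⟨d', hd'⟩ := hfc.exists_difference hC (w ≫ kernel.ι d ≫ kernel.ι η) (𝟙 F)
      (by simpa using hw)
    obtain ⟨d'', rfl⟩ := huniv d' (by simpa using (hfc.isAbelianObj hC).cooperate_self d')
    have hs : kernel.ι η ≫ w ≫ kernel.ι d = 𝟙 _ := by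
      simpa [← cancel_mono (kernel.ι η)] using hd' (kernel.ι η) (by simp)
    have hs' := (kernel.ι η ≫ w) ≫= hd (kernel.ι d) (by simp)
    simpa [reassoc_of% hs] using hs'
  · rintro ⟨U, u, ⟨⟨hu⟩, -⟩, huniv⟩ A a ⟨φ, h₁, h₂⟩
    have := hu.epi
    have hg : IsCentralExt (prod.fst : Y ⨯ A ⟶ Y) := by
      have : IsSplitEpi (prod.fst : Y ⨯ A ⟶ Y) := ⟨⟨⟨prod.lift (𝟙 Y) 0, by simp⟩⟩⟩
      refine ⟨⟨.ofSplitEpi _⟩, prod.lift (prod.snd ≫ prod.fst)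
        (prod.lift (prod.fst ≫ kernel.ι _ ≫ prod.snd) (prod.snd ≫ prod.snd) ≫ φ), ?_, ?_⟩
      · have : prod.lift (𝟙 (kernel (prod.fst : Y ⨯ A ⟶ Y))) (0 : _ ⟶ Y ⨯ A) ≫
            prod.lift (prod.fst ≫ kernel.ι _ ≫ prod.snd) (prod.snd ≫ prod.snd) =
              (kernel.ι _ ≫ prod.snd) ≫ prod.lift (𝟙 A) 0 := by ext <;> simp
        ext
        · simp
        · simp only [Category.assoc, prod.lift_snd]
          rw [reassoc_of% this, h₁, Category.comp_id]
      · have : prod.lift (0 : _ ⟶ kernel (prod.fst : Y ⨯ A ⟶ Y)) (𝟙 (Y ⨯ A)) ≫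
            prod.lift (prod.fst ≫ kernel.ι _ ≫ prod.snd) (prod.snd ≫ prod.snd) =
              prod.snd ≫ prod.lift 0 (𝟙 A) := by ext <;> simp
        ext
        · simp
        · simp only [Category.assoc, prod.lift_snd]
          rw [reassoc_of% this, h₂, Category.comp_id, Category.id_comp]
    have := (huniv _ _ hg).unique (y₁ := prod.lift u (u ≫ a)) (y₂ := prod.lift u 0)
      (by simp) (by simp)
    rw [← cancel_epi u]
    simpa using this =≫ prod.snd
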